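/- arXiv:2308.15277 — 4 statements merged into one kernel-verified Lean document; each statement's English description precedes it below -/
import Mathlib

section
/- Let E be a nontrivial real Banach space and let ω : [0,∞) → [0,∞) be concave, nondecreasing, not identically zero, with ω(0) = 0. Endow 𝒞_ω(E) with the topology of uniform convergence on bounded sets. Then there is a meagre set ℳ ⊂ 𝒞_ω(E) such that every f ∈ 𝒞_ω(E) \ ℳ satisfies ω_f(s) = ω(s) for every s ≥ 0; equivalently, the set {f ∈ 𝒞_ω(E) : ∃ s > 0 with ω_f(s) < ω(s)} is meagre. -/
open Set Bornology

/-- A concave function on `[0, ∞)` vanishing at `0` is subhomogeneous. -/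
lemma ConcaveOn.mul_le_map_mul {ω : ℝ → ℝ} (hconc : ConcaveOn ℝ (Ici 0) ω) (h0 : ω 0 = 0)
    {t s : ℝ} (ht0 : 0 ≤ t) (ht1 : t ≤ 1) (hs : 0 ≤ s) : t * ω s ≤ ω (t * s) := by
  have h := hconc.2 (mem_Ici.2 hs) (mem_Ici.2 le_rfl) ht0 (sub_nonneg.2 ht1) (by ring)
  simpa [h0] using h

lemma ConcaveOn.map_mul_le_mul {ω : ℝ → ℝ} (hconc : ConcaveOn ℝ (Ici 0) ω) (h0 : ω 0 = 0)
    {k s : ℝ} (hk : 1 ≤ k) (hs : 0 ≤ s) : ω (k * s) ≤ k * ω s := by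
  have hk0 : 0 < k := by linarith
  have h := hconc.mul_le_map_mul h0 (inv_nonneg.2 hk0.le) (inv_le_one_of_one_le₀ hk)
    (mul_nonneg hk0.le hs)
  rwa [inv_mul_cancel_left₀ hk0.ne', inv_mul_le_iff₀ hk0] at h

/-- A concave function on `[0, ∞)` vanishing at `0` is subadditive. -/
lemma ConcaveOn.map_add_le_add {ω : ℝ → ℝ} (hconc : ConcaveOn ℝ (Ici 0) ω) (h0 : ω 0 = 0)
    {a b : ℝ} (ha : 0 ≤ a) (hb : 0 ≤ b) : ω (a + b) ≤ ω a + ω b := by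
  rcases (add_nonneg ha hb).eq_or_lt' with hab | hab
  · obtain rfl : a = 0 := by linarith
    obtain rfl : b = 0 := by linarith
    simp [h0]
  · have h1 := hconc.mul_le_map_mul h0 (div_nonneg ha hab.le)
      ((div_le_one hab).2 (by linarith)) hab.le
    have h2 := hconc.mul_le_map_mul h0 (div_nonneg hb hab.le)
      ((div_le_one hab).2 (by linarith)) hab.le
    rw [div_mul_cancel₀ _ hab.ne'] at h1 h2
    have h3 : a / (a + b) * ω (a + b) + b / (a + b) * ω (a + b) = ω (a + b) := by
      field_simp
    linarith

lemma ConcaveOn.pos_of_nonneg_of_ne_zero {ω : ℝ → ℝ} (hconc : ConcaveOn ℝ (Ici 0) ω)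
    (hnonneg : ∀ s, 0 ≤ s → 0 ≤ ω s) (hmono : MonotoneOn ω (Ici 0)) (h0 : ω 0 = 0)
    (hne : ∃ s, 0 < s ∧ ω s ≠ 0) {s : ℝ} (hs : 0 < s) : 0 < ω s := by
  obtain ⟨t, ht, hωt⟩ := hne
  have htpos : 0 < ω t := (hnonneg t ht.le).lt_of_ne' hωt
  rcases le_total s t with hst | hst
  · have h := hconc.mul_le_map_mul h0 (div_nonneg hs.le ht.le) ((div_le_one ht).2 hst) ht.le
    rw [div_mul_cancel₀ _ ht.ne'] at h
    exact (mul_pos (div_pos hs ht) htpos).trans_le h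
  · exact htpos.trans_le (hmono ht.le hs.le hst)

lemma abs_sub_le_of_modulus {E : Type*} [NormedAddCommGroup E] {ω : ℝ → ℝ}
    (hconc : ConcaveOn ℝ (Ici 0) ω) (hmono : MonotoneOn ω (Ici 0)) (h0 : ω 0 = 0) (x y : E) :
    |ω ‖x‖ - ω ‖y‖| ≤ ω ‖x - y‖ := by
  have key : ∀ u v : E, ω ‖u‖ ≤ ω ‖v‖ + ω ‖u - v‖ := fun u v =>
    (hmono (norm_nonneg u) (add_nonneg (norm_nonneg v) (norm_nonneg (u - v)))
      (by simpa using norm_add_le v (u - v))).trans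
      (hconc.map_add_le_add h0 (norm_nonneg v) (norm_nonneg (u - v)))
  have h1 := key x y
  have h2 := key y x
  rw [norm_sub_rev] at h2
  exact abs_sub_le_iff.2 ⟨by linarith, by linarith⟩

/-- A normed space carries almost nonexpansive maps that are the identity on a given ball and
vanish far away. -/
lemma exists_lipschitz_eq_id_eq_zero (E : Type*) [NormedAddCommGroup E] [NormedSpace ℝ E]
    {R δ : ℝ} (hR : 0 < R) (hδ : 0 < δ) :
    ∃ (r : ℝ) (P : E → E), R ≤ r ∧ (∀ x y, ‖P x - P y‖ ≤ (1 + δ) * ‖x - y‖) ∧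
      (∀ x, ‖x‖ ≤ R → P x = x) ∧ (∀ x, r ≤ ‖x‖ → P x = 0) ∧ ∀ x, ‖P x‖ ≤ r := by
  set θ : E → ℝ := fun x => max 0 (1 - δ * Real.log (max ‖x‖ R / R)) with hθ
  have hm : ∀ x : E, 0 < max ‖x‖ R := fun x => hR.trans_le (le_max_right _ _)
  have hθ0 : ∀ x, 0 ≤ θ x := fun x => le_max_left _ _
  have hθ1 : ∀ x, θ x ≤ 1 := fun x => by
    refine max_le zero_le_one ?_
    have : 0 ≤ Real.log (max ‖x‖ R / R) :=
      Real.log_nonneg ((one_le_div hR).2 (le_max_right _ _))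
    nlinarith
  have hfar : ∀ x, R * Real.exp (1 / δ) ≤ ‖x‖ → θ x = 0 := fun x hx => by
    refine max_eq_left ?_
    have h1 : 1 / δ ≤ Real.log (max ‖x‖ R / R) := by
      rw [Real.le_log_iff_exp_le (div_pos (hm x) hR), le_div_iff₀ hR]
      linarith [le_max_left ‖x‖ R]
    rw [div_le_iff₀ hδ] at h1
    linarith
  have hlip : ∀ x y : E, ‖y‖ ≤ ‖x‖ → ‖θ x • x - θ y • y‖ ≤ (1 + δ) * ‖x - y‖ := by
    intro x y hyx
    have hmax : max ‖y‖ R ≤ max ‖x‖ R := max_le_max_right _ hyx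
    have hlog : Real.log (max ‖x‖ R / R) - Real.log (max ‖y‖ R / R) ≤
        (‖x‖ - ‖y‖) / max ‖y‖ R := by
      rw [Real.log_div (hm x).ne' hR.ne', Real.log_div (hm y).ne' hR.ne', sub_sub_sub_cancel_right,
        ← Real.log_div (hm x).ne' (hm y).ne']
      refine (Real.log_le_sub_one_of_pos (div_pos (hm x) (hm y))).trans ?_
      rw [div_sub_one (hm y).ne']
      refine div_le_div_of_nonneg_right ?_ (hm y).le
      rcases le_total ‖x‖ R with h | h
      · rw [max_eq_right h, max_eq_right (hyx.trans h)]; linarith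
      · rw [max_eq_left h]; linarith [le_max_left ‖y‖ R]
    have hlog0 : Real.log (max ‖y‖ R / R) ≤ Real.log (max ‖x‖ R / R) :=
      Real.log_le_log (div_pos (hm y) hR) (div_le_div_of_nonneg_right hmax hR.le)
    have habs : |θ x - θ y| ≤ δ * ((‖x‖ - ‖y‖) / max ‖y‖ R) := by
      refine (abs_max_sub_max_le_max _ _ _ _).trans ?_
      rw [sub_self, abs_zero, max_eq_right (abs_nonneg _), abs_le]
      constructor <;> nlinarith
    have hy : |θ x - θ y| * ‖y‖ ≤ δ * (‖x‖ - ‖y‖) := by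
      calc |θ x - θ y| * ‖y‖ ≤ δ * ((‖x‖ - ‖y‖) / max ‖y‖ R) * max ‖y‖ R :=
            mul_le_mul habs (le_max_left _ _) (norm_nonneg _) ((abs_nonneg _).trans habs)
        _ = δ * (‖x‖ - ‖y‖) := by rw [mul_assoc, div_mul_cancel₀ _ (hm y).ne']
    calc ‖θ x • x - θ y • y‖ = ‖θ x • (x - y) + (θ x - θ y) • y‖ := by congr 1; module
      _ ≤ θ x * ‖x - y‖ + |θ x - θ y| * ‖y‖ := by
          refine (norm_add_le _ _).trans_eq ?_
          rw [norm_smul, norm_smul, Real.norm_of_nonneg (hθ0 x), Real.norm_eq_abs]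
      _ ≤ 1 * ‖x - y‖ + δ * ‖x - y‖ := by
          refine add_le_add (mul_le_mul_of_nonneg_right (hθ1 x) (norm_nonneg _)) (hy.trans ?_)
          exact mul_le_mul_of_nonneg_left (norm_sub_norm_le x y) hδ.le
      _ = (1 + δ) * ‖x - y‖ := by ring
  have hRr : R ≤ R * Real.exp (1 / δ) :=
    le_mul_of_one_le_right hR.le (Real.one_le_exp (by positivity))
  refine ⟨R * Real.exp (1 / δ), fun x => θ x • x, hRr, fun x y => ?_, fun x hx => ?_,
    fun x hx => by simp [hfar x hx], fun x => ?_⟩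
  · rcases le_total ‖y‖ ‖x‖ with h | h
    · exact hlip x y h
    · rw [norm_sub_rev, norm_sub_rev x]; exact hlip y x h
  · simp [hθ, max_eq_right hx, hR.ne']
  · rcases le_total (R * Real.exp (1 / δ)) ‖x‖ with h | h
    · simpa [hfar x h] using hR.le.trans hRr
    · rw [norm_smul, Real.norm_of_nonneg (hθ0 x)]
      exact (mul_le_of_le_one_left (norm_nonneg x) (hθ1 x)).trans h

/-- For a map `f` with values in a nontrivial normed space one can find a point `q` at distance
nearly `m` from a value `f x₁`, without making the range of `f` essentially wider. -/
lemma exists_extend_range {X E : Type*} [Nonempty X] [NormedAddCommGroup E] [NormedSpace ℝ E]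
    [Nontrivial E] (f : X → E) {m ε : ℝ} (hm : 0 < m) (hε : 0 < ε) :
    ∃ (x₁ x₂ : X) (q : E), m - ε < ‖q - f x₁‖ ∧ ‖q - f x₁‖ ≤ m ∧
      ∀ w, ‖f w - q‖ ≤ max m (max ‖f w - f x₁‖ ‖f w - f x₂‖) := by
  by_cases hA : ∃ x₁ x₂, m - ε < ‖f x₂ - f x₁‖
  · obtain ⟨x₁, x₂, hx⟩ := hA
    set t : ℝ := min 1 (m / ‖f x₂ - f x₁‖) with ht
    have ht0 : 0 ≤ t := le_min zero_le_one (div_nonneg hm.le (norm_nonneg _))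
    have ht1 : t ≤ 1 := min_le_left _ _
    have hnorm : ‖f x₁ + t • (f x₂ - f x₁) - f x₁‖ = min ‖f x₂ - f x₁‖ m ∨
        ‖f x₂ - f x₁‖ = 0 := by
      rcases (norm_nonneg (f x₂ - f x₁)).eq_or_lt' with h | h
      · exact Or.inr h
      · left
        rw [add_sub_cancel_left, norm_smul, Real.norm_of_nonneg ht0, ht,
          min_mul_of_nonneg _ _ h.le, one_mul, div_mul_cancel₀ _ h.ne']
    refine ⟨x₁, x₂, f x₁ + t • (f x₂ - f x₁), ?_, ?_, fun w => le_max_of_le_right ?_⟩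
    · rcases hnorm with h | h
      · rw [h]; exact lt_min hx (by linarith)
      · rw [h] at hx; exact hx.trans_le (norm_nonneg _)
    · rcases hnorm with h | h
      · rw [h]; exact min_le_right _ _
      · rw [add_sub_cancel_left, norm_smul, h, mul_zero]; exact hm.le
    · have hw : f w - (f x₁ + t • (f x₂ - f x₁)) =
          (1 - t) • (f w - f x₁) + t • (f w - f x₂) := by module
      rw [hw]
      refine (norm_add_le _ _).trans ?_
      rw [norm_smul, norm_smul, Real.norm_of_nonneg ht0, Real.norm_of_nonneg (sub_nonneg.2 ht1)]
      nlinarith [le_max_left ‖f w - f x₁‖ ‖f w - f x₂‖, le_max_right ‖f w - f x₁‖ ‖f w - f x₂‖]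
  · push Not at hA
    set S : Set ℝ := range fun z : X × X => ‖f z.2 - f z.1‖
    have hbdd : BddAbove S := ⟨m - ε, by rintro _ ⟨z, rfl⟩; exact hA z.1 z.2⟩
    have hD : ∀ x y, ‖f y - f x‖ ≤ sSup S := fun x y => le_csSup hbdd ⟨(x, y), rfl⟩
    have hDm : sSup S ≤ m - ε := csSup_le (range_nonempty _) (by rintro _ ⟨z, rfl⟩; exact hA z.1 z.2)
    obtain ⟨_, ⟨⟨x₁, x₂⟩, rfl⟩, hx⟩ := exists_lt_of_lt_csSup (range_nonempty _)
      (show sSup S - ε < sSup S by linarith)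
    have hu : ∃ u : E, ‖u‖ = 1 ∧ f x₂ - f x₁ = ‖f x₂ - f x₁‖ • u := by
      by_cases h : f x₂ - f x₁ = 0
      · obtain ⟨u, hu⟩ := exists_norm_eq E zero_le_one
        exact ⟨u, hu, by simp [h]⟩
      · exact ⟨‖f x₂ - f x₁‖⁻¹ • (f x₂ - f x₁), norm_smul_inv_norm (𝕜 := ℝ) h,
          (smul_inv_smul₀ (norm_ne_zero_iff.2 h) _).symm⟩
    obtain ⟨u, hu1, hu⟩ := hu
    have hτ : 0 ≤ m - sSup S := by linarith
    have hq : ‖f x₂ + (m - sSup S) • u - f x₁‖ = ‖f x₂ - f x₁‖ + (m - sSup S) := by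
      rw [show f x₂ + (m - sSup S) • u - f x₁ = (‖f x₂ - f x₁‖ + (m - sSup S)) • u by
        rw [add_smul, ← hu]; module, norm_smul, hu1, mul_one, Real.norm_of_nonneg (by positivity)]
    refine ⟨x₁, x₂, f x₂ + (m - sSup S) • u, ?_, ?_, fun w => le_max_of_le_left ?_⟩
    · rw [hq]; simp only at hx; linarith
    · rw [hq]; linarith [hD x₁ x₂]
    · rw [← sub_sub]
      refine (norm_sub_le _ _).trans ?_
      rw [norm_smul, hu1, mul_one, Real.norm_of_nonneg hτ]
      linarith [hD x₂ w]

/-- Maps with modulus `ω` can be modified far away from a bounded set so that their oscillation at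
scale `s` nearly reaches `ω s`. -/
lemma exists_near_of_modulus {E : Type*} [NormedAddCommGroup E] [NormedSpace ℝ E] [Nontrivial E]
    {ω : ℝ → ℝ} (hpos : ∀ s, 0 < s → 0 < ω s) (hconc : ConcaveOn ℝ (Ici 0) ω)
    (hmono : MonotoneOn ω (Ici 0)) (h0 : ω 0 = 0) {f : E → E}
    (hf : ∀ x y, ‖f x - f y‖ ≤ ω ‖x - y‖) {s ε η : ℝ} (hs : 0 < s) (hε : 0 < ε) (hη : 0 < η)
    {B : Set E} (hB : IsBounded B) :
    ∃ g : E → E, (∀ x y, ‖g x - g y‖ ≤ ω ‖x - y‖) ∧ (∀ x ∈ B, ‖g x - f x‖ < η) ∧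
      ∃ x y, ‖x - y‖ ≤ s ∧ ω s - ε < ‖g x - g y‖ := by
  obtain ⟨x₁, x₂, q, hq1, hq2, hq⟩ := exists_extend_range f (hpos s hs) hε
  obtain ⟨R, hR, hBR⟩ := (hB.insert x₂).subset_closedBall_lt 0 x₁
  have hωR := hpos R hR
  set δ : ℝ := η / (ω R + 1)
  have hδ : 0 < δ := by positivity
  obtain ⟨r, P, hRr, hPlip, hPid, hPfar, hPr⟩ := exists_lipschitz_eq_id_eq_zero E hR hδ
  set κ : ℝ := (1 + δ)⁻¹ with hκ
  have hκ0 : 0 < κ := by positivity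
  have hκ1 : κ ≤ 1 := inv_le_one_of_one_le₀ (by linarith)
  set L : ℝ := max s (2 * r)
  have hsL : s ≤ L := le_max_left _ _
  have hrL : 2 * r ≤ L := le_max_right _ _
  have hL0 : 0 ≤ L := hs.le.trans hsL
  obtain ⟨v, hv⟩ := exists_norm_eq E (show 0 ≤ r + L + s by linarith)
  set z : E := x₁ + v with hz
  set Q : E → E := fun x => x₁ + P (x - x₁) with hQ
  set χ : E → ℝ := fun x => max 0 (1 - ω ‖x - z‖ / ω s) with hχ
  have hωs := hpos s hs
  have hnn : ∀ t, 0 ≤ t → 0 ≤ ω t := fun t ht => by simpa [h0] using hmono self_mem_Ici ht ht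
  have hχ0 : ∀ x, 0 ≤ χ x := fun x => le_max_left _ _
  have hχ1 : ∀ x, χ x ≤ 1 := fun x => max_le zero_le_one <| by
    have := div_nonneg (hnn ‖x - z‖ (norm_nonneg _)) hωs.le
    linarith
  have hχfar : ∀ x, s ≤ ‖x - z‖ → χ x = 0 := fun x hx => max_eq_left <| by
    have := (one_le_div hωs).2 (hmono hs.le (norm_nonneg (x - z)) hx)
    linarith
  have hχlip : ∀ x y, |χ x - χ y| * ω s ≤ ω ‖x - y‖ := fun x y => by
    rw [← le_div_iff₀ hωs]
    refine (abs_max_sub_max_le_max _ _ _ _).trans ?_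
    rw [sub_self, abs_zero, max_eq_right (abs_nonneg _), sub_sub_sub_cancel_left, ← sub_div,
      abs_div, abs_of_pos hωs]
    refine div_le_div_of_nonneg_right ?_ hωs.le
    simpa [abs_sub_comm] using abs_sub_le_of_modulus hconc hmono h0 (x - z) (y - z)
  have hχnear : ∀ x, ‖x - x₁‖ ≤ r + L → χ x = 0 := fun x hx => hχfar x <| by
    have h := norm_sub_norm_le v (x - x₁)
    rw [show v - (x - x₁) = z - x by rw [hz]; abel, norm_sub_rev z] at h
    linarith
  have hQfar : ∀ x, r ≤ ‖x - x₁‖ → Q x = x₁ := fun x hx => by simp [hQ, hPfar _ hx]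
  have hQr : ∀ x, ‖Q x - x₁‖ ≤ r := fun x => by simpa [hQ] using hPr (x - x₁)
  have hQlip : ∀ x y, ‖Q x - Q y‖ ≤ (1 + δ) * ‖x - y‖ := fun x y => by
    simpa [hQ] using hPlip (x - x₁) (y - x₁)
  -- the values of `f` on the ball of radius `r` about `x₁` are within `ω L` of each other
  have hball : ∀ w w' : E, ‖w - x₁‖ ≤ r → ‖w' - x₁‖ ≤ r → ‖f w - f w'‖ ≤ ω L :=
    fun w w' hw hw' =>
    (hf w w').trans <| hmono (norm_nonneg _) hL0 <| by
      have := norm_sub_le (w - x₁) (w' - x₁)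
      rw [sub_sub_sub_cancel_right] at this
      linarith
  have hx₁ : ‖x₁ - x₁‖ ≤ r := by simpa using hR.le.trans hRr
  have hx₂ : ‖x₂ - x₁‖ ≤ r :=
    (mem_closedBall_iff_norm.1 (hBR (mem_insert _ _))).trans hRr
  set S : Set E := insert q (f '' {w | ‖w - x₁‖ ≤ r})
  have hqball : ∀ w, ‖w - x₁‖ ≤ r → dist (f w) q ≤ ω L := fun w hw => by
    rw [dist_eq_norm]
    exact (hq w).trans (max_le (hmono hs.le hL0 hsL)
      (max_le (hball w x₁ hw hx₁) (hball w x₂ hw hx₂)))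
  have hSdist : ∀ a ∈ S, ∀ b ∈ S, dist a b ≤ ω L := by
    rintro _ (rfl | ⟨w, hw, rfl⟩) _ (rfl | ⟨w', hw', rfl⟩)
    · simpa using hnn L hL0
    · rw [dist_comm]; exact hqball w' hw'
    · exact hqball w hw
    · rw [dist_eq_norm]; exact hball w w' hw hw'
  set g : E → E := fun x => f x₁ + κ • (f (Q x) - f x₁) + χ x • (q - f x₁) with hg
  have hgnear : ∀ x, χ x = 0 → g x = f x₁ + κ • (f (Q x) - f x₁) := fun x hx => by
    simp [hg, hx]
  have hgfar : ∀ x, r ≤ ‖x - x₁‖ → g x = f x₁ + χ x • (q - f x₁) := fun x hx => by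
    simp [hg, hQfar x hx]
  have hgS : ∀ x, g x ∈ convexHull ℝ S := fun x => by
    have hmem : ∀ w, ‖w - x₁‖ ≤ r → f w ∈ convexHull ℝ S := fun w hw =>
      subset_convexHull ℝ S (mem_insert_of_mem _ ⟨w, hw, rfl⟩)
    rcases le_total r ‖x - x₁‖ with h | h
    · rw [hgfar x h]
      exact (convex_convexHull ℝ S).add_smul_sub_mem (hmem x₁ hx₁)
        (subset_convexHull ℝ S (mem_insert _ _)) ⟨hχ0 x, hχ1 x⟩
    · rw [hgnear x (hχnear x (by linarith))]
      exact (convex_convexHull ℝ S).add_smul_sub_mem (hmem x₁ hx₁) (hmem _ (hQr x))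
        ⟨hκ0.le, hκ1⟩
  refine ⟨g, fun x y => ?_, fun x hx => ?_, ?_⟩
  · rcases le_total L ‖x - y‖ with hxy | hxy
    · obtain ⟨a, ha, b, hb, hab⟩ := convexHull_exists_dist_ge2 (hgS x) (hgS y)
      rw [← dist_eq_norm]
      exact hab.trans ((hSdist a ha b hb).trans (hmono hL0 (norm_nonneg _) hxy))
    · have htri : ‖x - x₁‖ ≤ ‖y - x₁‖ + ‖x - y‖ := by
        simpa [add_comm] using norm_add_le (x - y) (y - x₁)
      have htri' : ‖y - x₁‖ ≤ ‖x - x₁‖ + ‖x - y‖ := by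
        simpa [add_comm, norm_sub_rev x y] using norm_add_le (y - x) (x - x₁)
      by_cases h : r ≤ ‖x - x₁‖ ∧ r ≤ ‖y - x₁‖
      · rw [hgfar x h.1, hgfar y h.2, add_sub_add_left_eq_sub, ← sub_smul, norm_smul,
          Real.norm_eq_abs]
        exact (mul_le_mul_of_nonneg_left hq2 (abs_nonneg _)).trans (hχlip x y)
      · have hnear : ‖x - x₁‖ ≤ r + L ∧ ‖y - x₁‖ ≤ r + L := by
          rw [not_and_or, not_le, not_le] at h
          rcases h with h | h <;> constructor <;> linarith
        rw [hgnear x (hχnear x hnear.1), hgnear y (hχnear y hnear.2), add_sub_add_left_eq_sub,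
          ← smul_sub, sub_sub_sub_cancel_right, norm_smul, Real.norm_of_nonneg hκ0.le, hκ,
          inv_mul_le_iff₀ (by positivity)]
        exact (hf _ _).trans ((hmono (norm_nonneg _) (mem_Ici.2 (by positivity)) (hQlip x y)).trans
          (hconc.map_mul_le_mul h0 (by linarith) (norm_nonneg _)))
  · have hxR : ‖x - x₁‖ ≤ R := mem_closedBall_iff_norm.1 (hBR (mem_insert_of_mem _ hx))
    have hQx : Q x = x := by simp [hQ, hPid _ hxR]
    rw [hgnear x (hχnear x (by linarith)), hQx,
      show f x₁ + κ • (f x - f x₁) - f x = (κ - 1) • (f x - f x₁) by module, norm_smul,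
      Real.norm_eq_abs, abs_sub_comm, abs_of_nonneg (sub_nonneg.2 hκ1)]
    have hκδ : 1 - κ ≤ δ := by
      have : κ * (1 + δ) = 1 := inv_mul_cancel₀ (by positivity)
      nlinarith
    calc (1 - κ) * ‖f x - f x₁‖ ≤ δ * ω R :=
          mul_le_mul hκδ ((hf _ _).trans (hmono (norm_nonneg _) hR.le hxR)) (norm_nonneg _) hδ.le
      _ < δ * (ω R + 1) := by nlinarith
      _ = η := div_mul_cancel₀ _ (by positivity)
  · obtain ⟨e, he⟩ := exists_norm_eq E hs.le
    have h1 : g z = q := by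
      rw [hgfar z (by simp only [hz, add_sub_cancel_left, hv]; linarith)]
      simp [hχ, h0]
    have h2 : g (z + e) = f x₁ := by
      rw [hgfar (z + e), hχfar (z + e) (by simp [he])]
      · simp
      · have := norm_sub_le (v + e) e
        rw [add_sub_cancel_right, hv, he] at this
        rw [show z + e - x₁ = v + e by rw [hz]; abel]
        linarith
    exact ⟨z, z + e, by simp [he], by rwa [h1, h2]⟩

/-- Theorem `theo:unifb` (normed-space instance): in `𝒞_ω(E)` with the topology of
uniform convergence on bounded sets (realised via `UniformOnFun` with the family of
bounded sets), there is a meagre set `ℳ` outside of which every map has modulus of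
continuity exactly `ω`; equivalently, the set of `f` with `ω_f(s) < ω(s)` for some
`s > 0` is meagre. -/
theorem stmt_0 {E : Type*} [NormedAddCommGroup E] [NormedSpace ℝ E]
    [CompleteSpace E] [Nontrivial E]
    (ω : ℝ → ℝ) (hnonneg : ∀ s, 0 ≤ s → 0 ≤ ω s)
    (hconc : ConcaveOn ℝ (Ici 0) ω) (hmono : MonotoneOn ω (Ici 0))
    (h0 : ω 0 = 0) (hne : ∃ s, 0 < s ∧ ω s ≠ 0) :
    IsMeagre {f : {g : UniformOnFun E E {s : Set E | IsBounded s} //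
        ∀ x y : E, ‖UniformOnFun.toFun _ g x - UniformOnFun.toFun _ g y‖ ≤ ω ‖x - y‖} |
      ∃ s : ℝ, 0 < s ∧
        sSup {d : ℝ | ∃ x y : E, ‖x - y‖ ≤ s ∧
          d = ‖UniformOnFun.toFun _ f.1 x - UniformOnFun.toFun _ f.1 y‖} < ω s} := by
  have hpos : ∀ s, 0 < s → 0 < ω s := fun s hs =>
    hconc.pos_of_nonneg_of_ne_zero hnonneg hmono h0 hne hs
  set X := {g : UniformOnFun E E {s : Set E | IsBounded s} //
    ∀ x y : E, ‖UniformOnFun.toFun _ g x - UniformOnFun.toFun _ g y‖ ≤ ω ‖x - y‖}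
  let U : {t : ℚ // 0 < t} × ℕ → Set X := fun i => {f | ∃ x y : E, ‖x - y‖ ≤ (i.1.1 : ℝ) ∧
    ω i.1.1 - 1 / ((i.2 : ℝ) + 1) <
      ‖UniformOnFun.toFun _ f.1 x - UniformOnFun.toFun _ f.1 y‖}
  have hopen : ∀ i, IsOpen (U i) := fun i => by
    have heval : ∀ x : E, Continuous fun f : X => UniformOnFun.toFun _ f.1 x := fun x =>
      (UniformOnFun.uniformContinuous_eval_of_mem E {s : Set E | IsBounded s}
        (mem_singleton x) isBounded_singleton).continuous.comp continuous_subtype_val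
    simp only [U, ofPred_exists, ofPred_and]
    exact isOpen_iUnion fun x => isOpen_iUnion fun y => isOpen_const.inter
      (isOpen_lt continuous_const ((heval x).sub (heval y)).norm)
  have hdense : ∀ i, Dense (U i) := fun i f => by
    have hbasis := (UniformOnFun.hasBasis_nhds_of_basis E E {s : Set E | IsBounded s} f.1
      ⟨∅, isBounded_empty⟩ (fun a ha b hb => ⟨a ∪ b, IsBounded.union ha hb, subset_union_left,
        subset_union_right⟩) Metric.uniformity_basis_dist).comap (Subtype.val : X → _)
    rw [← nhds_induced] at hbasis
    refine (mem_closure_iff_nhds_basis hbasis).2 ?_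
    rintro ⟨B, η⟩ ⟨hB, hη⟩
    obtain ⟨g, hg, hgB, hgU⟩ := exists_near_of_modulus hpos hconc hmono h0 f.2
      (Rat.cast_pos.2 i.1.2) (Nat.one_div_pos_of_nat (n := i.2)) hη hB
    refine ⟨⟨UniformOnFun.ofFun _ g, hg⟩, hgU, fun x hx => ?_⟩
    simpa [dist_eq_norm] using hgB x hx
  refine Filter.mem_of_superset
    (countable_iInter_mem.2 fun i => residual_of_dense_open (hopen i) (hdense i)) ?_
  rintro f hf ⟨s, hs, hlt⟩
  set A : Set ℝ := {d : ℝ | ∃ x y : E, ‖x - y‖ ≤ s ∧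
    d = ‖UniformOnFun.toFun _ f.1 x - UniformOnFun.toFun _ f.1 y‖}
  have hbdd : BddAbove A := ⟨ω s, by
    rintro _ ⟨x, y, hxy, rfl⟩
    exact (f.2 x y).trans (hmono (norm_nonneg _) hs.le hxy)⟩
  have hA0 : 0 ≤ sSup A := Real.sSup_nonneg (by rintro _ ⟨x, y, -, rfl⟩; exact norm_nonneg _)
  have hωs := hpos s hs
  obtain ⟨t, ht1, ht2⟩ := exists_rat_btwn
    (show sSup A / ω s * s < s from mul_lt_of_lt_one_left hs ((div_lt_one hωs).2 hlt))
  have ht0 : (0 : ℝ) < t := lt_of_le_of_lt (by positivity) ht1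
  have hωt : sSup A < ω t := by
    have h := hconc.mul_le_map_mul h0 (div_nonneg ht0.le hs.le) ((div_le_one hs).2 ht2.le) hs.le
    rw [div_mul_cancel₀ _ hs.ne'] at h
    refine lt_of_lt_of_le ?_ h
    rwa [← div_lt_iff₀ hωs, lt_div_iff₀ hs]
  obtain ⟨n, hn⟩ := exists_nat_one_div_lt (sub_pos.2 hωt)
  obtain ⟨x, y, hxy, h⟩ := mem_iInter.1 hf (⟨t, Rat.cast_pos.1 ht0⟩, n)
  have := le_csSup hbdd (show _ ∈ A from ⟨x, y, hxy.trans ht2.le, rfl⟩)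
  simp only at h
  linarith
end

section
/- Let E be a nontrivial real Banach space and let ω : [0,∞) → [0,∞) be concave, nondecreasing, not identically zero, with ω(0) = 0. Fix s > 0 and μ ∈ (0,1). Then the set N(s,μ) = {f ∈ 𝒞_ω(E) : dist(f x, f y) ≤ (1−μ)·ω(s) whenever ‖x−y‖ ≤ s} is nowhere dense in 𝒞_ω(E) for the topology of uniform convergence on bounded sets. -/
open Set Bornology

section Modulus

variable {ω : ℝ → ℝ}

/-- A concave function vanishing at `0` has nonincreasing slopes `ω t / t`. -/
theorem ConcaveOn.mul_le_mul_of_map_zero (hconc : ConcaveOn ℝ (Ici 0) ω) (h0 : ω 0 = 0)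
    {t u : ℝ} (ht : 0 ≤ t) (htu : t ≤ u) : ω u * t ≤ ω t * u := by
  rcases ht.eq_or_lt with rfl | ht'
  · simp [h0]
  have hu : 0 < u := ht'.trans_le htu
  have h := hconc.2 (mem_Ici.2 hu.le) (mem_Ici.2 (le_refl (0 : ℝ)))
    (by positivity : 0 ≤ t / u) (sub_nonneg.2 ((div_le_one hu).2 htu)) (add_sub_cancel _ _)
  simp only [smul_eq_mul, h0, mul_zero, add_zero, div_mul_cancel₀ t hu.ne'] at h
  rw [div_mul_eq_mul_div, div_le_iff₀ hu] at h
  linarith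

theorem ConcaveOn.map_add_le_of_map_zero (hconc : ConcaveOn ℝ (Ici 0) ω) (h0 : ω 0 = 0)
    {a b : ℝ} (ha : 0 ≤ a) (hb : 0 ≤ b) : ω (a + b) ≤ ω a + ω b := by
  rcases (add_nonneg ha hb).eq_or_lt with h | h
  · obtain rfl : a = 0 := by linarith
    simp [h0]
  have h1 := hconc.mul_le_mul_of_map_zero h0 ha (by linarith : a ≤ a + b)
  have h2 := hconc.mul_le_mul_of_map_zero h0 hb (by linarith : b ≤ a + b)
  exact le_of_mul_le_mul_right (by linarith) h

theorem ConcaveOn.map_pos_of_map_zero (hconc : ConcaveOn ℝ (Ici 0) ω)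
    (hmono : MonotoneOn ω (Ici 0)) (hnonneg : ∀ s, 0 ≤ s → 0 ≤ ω s) (h0 : ω 0 = 0)
    (hne : ∃ s, 0 < s ∧ ω s ≠ 0) {s : ℝ} (hs : 0 < s) : 0 < ω s := by
  obtain ⟨r, hr, hωr⟩ := hne
  have hωr' : 0 < ω r := (hnonneg r hr.le).lt_of_ne' hωr
  rcases le_total r s with h | h
  · exact hωr'.trans_le (hmono hr.le hs.le h)
  · have := hconc.mul_le_mul_of_map_zero h0 hs.le h
    exact pos_of_mul_pos_left ((mul_pos hωr' hs).trans_le this) hr.le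

end Modulus

section Construction

variable {E : Type*} [NormedAddCommGroup E] [NormedSpace ℝ E] {ω : ℝ → ℝ}

/-- The real profile `max 0 (ω s - ω r)` of a bump has modulus of continuity `ω`. -/
theorem abs_max_sub_max_le (hconc : ConcaveOn ℝ (Ici 0) ω) (hmono : MonotoneOn ω (Ici 0))
    (h0 : ω 0 = 0) (c : ℝ) {a b t : ℝ} (ha : 0 ≤ a) (hb : 0 ≤ b) (hab : |a - b| ≤ t) :
    |max 0 (c - ω a) - max 0 (c - ω b)| ≤ ω t := by
  have key : ∀ a b : ℝ, 0 ≤ a → 0 ≤ b → |a - b| ≤ t → ω a - ω b ≤ ω t := by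
    intro a b ha hb hab
    have ht : 0 ≤ t := (abs_nonneg _).trans hab
    have h1 : ω a ≤ ω (b + t) :=
      hmono ha (add_nonneg hb ht) (by linarith [(abs_le.1 hab).2])
    linarith [hconc.map_add_le_of_map_zero h0 hb ht]
  have h1 := key a b ha hb hab
  have h2 := key b a hb ha (by rwa [abs_sub_comm])
  have h3 := abs_max_sub_max_le_abs (c - ω a) (c - ω b) 0
  rw [max_comm 0, max_comm 0]
  refine h3.trans (abs_le.2 ⟨by linarith, by linarith⟩)

/-- A map with a little slack can be deformed far away from the origin to be constant. -/
theorem exists_eq_const_far (hconc : ConcaveOn ℝ (Ici 0) ω)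
    (hnonneg : ∀ s, 0 ≤ s → 0 ≤ ω s) (hmono : MonotoneOn ω (Ici 0)) (h0 : ω 0 = 0)
    {f : E → E} {δ : ℝ} (hδ : 0 < δ) (hδ1 : δ < 1)
    (hf : ∀ x y, ‖f x - f y‖ ≤ (1 - δ) * ω ‖x - y‖) {p : E} {T : ℝ} (hT : 0 < T)
    (hp : ∀ y, ‖p - f y‖ ≤ ω (T + ‖y‖)) {R : ℝ} (hR : 0 ≤ R) :
    ∃ (g : E → E) (R' : ℝ), R ≤ R' ∧ (∀ x y, ‖g x - g y‖ ≤ ω ‖x - y‖) ∧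
      (∀ x, ‖x‖ ≤ R → g x = f x) ∧ (∀ x, R' ≤ ‖x‖ → g x = p) ∧
      ∀ x, ∃ c ∈ Icc (0 : ℝ) 1, g x = (1 - c) • f x + c • p := by
  let ℓ : E → ℝ := fun x ↦ δ * (Real.log (T + ‖x‖) - Real.log (T + R))
  let χ : E → ℝ := fun x ↦ max 0 (min 1 (ℓ x))
  have hpos : ∀ x : E, 0 < T + ‖x‖ := fun x ↦ by positivity
  have hχ0 : ∀ x, 0 ≤ χ x := fun x ↦ le_max_left _ _
  have hχ1 : ∀ x, χ x ≤ 1 := fun x ↦ max_le zero_le_one (min_le_left _ _)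
  let g : E → E := fun x ↦ (1 - χ x) • f x + χ x • p
  have hχlip : ∀ x y, χ y ≤ χ x → (χ x - χ y) * (T + ‖y‖) ≤ δ * ‖x - y‖ := by
    intro x y hxy
    rcases le_total (ℓ x) (ℓ y) with h | h
    · have : χ x ≤ χ y := max_le_max le_rfl (min_le_min le_rfl h)
      have : χ x - χ y = 0 := by linarith
      rw [this, zero_mul]
      positivity
    · have h1 : χ x - χ y ≤ ℓ x - ℓ y := by
        have e1 := abs_max_sub_max_le_abs (min 1 (ℓ x)) (min 1 (ℓ y)) 0
        have e2 := abs_min_sub_min_le_max 1 (ℓ x) 1 (ℓ y)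
        rw [sub_self, abs_zero, max_eq_right (abs_nonneg _), abs_of_nonneg (sub_nonneg.2 h)] at e2
        rw [max_comm _ 0, max_comm _ 0] at e1
        exact (le_abs_self _).trans (e1.trans e2)
      have h2 : ℓ x - ℓ y ≤ δ * ((T + ‖x‖) / (T + ‖y‖) - 1) := by
        have := Real.log_le_sub_one_of_pos (div_pos (hpos x) (hpos y))
        rw [Real.log_div (hpos x).ne' (hpos y).ne'] at this
        have := mul_le_mul_of_nonneg_left this hδ.le
        simp only [ℓ]
        linarith
      calc (χ x - χ y) * (T + ‖y‖) ≤ δ * ((T + ‖x‖) / (T + ‖y‖) - 1) * (T + ‖y‖) :=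
            mul_le_mul_of_nonneg_right (h1.trans h2) (hpos y).le
        _ = δ * (‖x‖ - ‖y‖) := by field_simp [(hpos y).ne']; ring
        _ ≤ δ * ‖x - y‖ := mul_le_mul_of_nonneg_left (norm_sub_norm_le x y) hδ.le
  have main : ∀ x y, χ y ≤ χ x → ‖g x - g y‖ ≤ ω ‖x - y‖ := by
    intro x y hxy
    have hsplit : g x - g y = (1 - χ x) • (f x - f y) + (χ x - χ y) • (p - f y) := by
      simp only [g]; module
    have ht := hnonneg _ (norm_nonneg (x - y))
    have hb : ‖g x - g y‖ ≤
        (1 - χ x) * ((1 - δ) * ω ‖x - y‖) + (χ x - χ y) * ω (T + ‖y‖) := by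
      rw [hsplit]
      refine (norm_add_le _ _).trans ?_
      rw [norm_smul, norm_smul, Real.norm_of_nonneg (sub_nonneg.2 (hχ1 x)),
        Real.norm_of_nonneg (sub_nonneg.2 hxy)]
      exact add_le_add (mul_le_mul_of_nonneg_left (hf x y) (sub_nonneg.2 (hχ1 x)))
        (mul_le_mul_of_nonneg_left (hp y) (sub_nonneg.2 hxy))
    refine hb.trans ?_
    rcases le_total (T + ‖y‖) ‖x - y‖ with h | h
    · have h1 : ω (T + ‖y‖) ≤ ω ‖x - y‖ := hmono (hpos y).le (norm_nonneg _) h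
      have h2 := mul_le_mul_of_nonneg_left h1 (sub_nonneg.2 hxy)
      nlinarith [mul_nonneg (hχ0 y) ht, mul_nonneg (sub_nonneg.2 (hχ1 x)) (mul_nonneg hδ.le ht)]
    · have h1 := hconc.mul_le_mul_of_map_zero h0 (norm_nonneg (x - y)) h
      have h2 : (χ x - χ y) * ω (T + ‖y‖) ≤ δ * ω ‖x - y‖ := by
        refine le_of_mul_le_mul_right ?_ (hpos y)
        calc (χ x - χ y) * ω (T + ‖y‖) * (T + ‖y‖)
            = (χ x - χ y) * (T + ‖y‖) * ω (T + ‖y‖) := by ring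
          _ ≤ δ * ‖x - y‖ * ω (T + ‖y‖) :=
            mul_le_mul_of_nonneg_right (hχlip x y hxy) (hnonneg _ (hpos y).le)
          _ = δ * (ω (T + ‖y‖) * ‖x - y‖) := by ring
          _ ≤ δ * (ω ‖x - y‖ * (T + ‖y‖)) := mul_le_mul_of_nonneg_left h1 hδ.le
          _ = δ * ω ‖x - y‖ * (T + ‖y‖) := by ring
      nlinarith [mul_nonneg (hχ0 x) (mul_nonneg (sub_nonneg.2 hδ1.le) ht)]
  refine ⟨g, (T + R) * Real.exp (1 / δ), ?_, ?_, ?_, ?_, ?_⟩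
  · have : 1 ≤ Real.exp (1 / δ) := Real.one_le_exp (by positivity)
    nlinarith
  · intro x y
    rcases le_total (χ y) (χ x) with h | h
    · exact main x y h
    · rw [norm_sub_rev, norm_sub_rev x]
      exact main y x h
  · intro x hx
    have h1 : ℓ x ≤ 0 := mul_nonpos_of_nonneg_of_nonpos hδ.le
      (sub_nonpos.2 (Real.log_le_log (hpos x) (by linarith)))
    have h2 : χ x = 0 := max_eq_left ((min_le_right _ _).trans h1)
    simp [g, h2]
  · intro x hx
    have hTR : 0 < T + R := by positivity
    have h1 : 1 ≤ ℓ x := by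
      have : Real.log ((T + R) * Real.exp (1 / δ)) ≤ Real.log (T + ‖x‖) :=
        Real.log_le_log (by positivity) (by linarith)
      rw [Real.log_mul hTR.ne' (Real.exp_ne_zero _), Real.log_exp] at this
      have := mul_le_mul_of_nonneg_left (by linarith :
        1 / δ ≤ Real.log (T + ‖x‖) - Real.log (T + R)) hδ.le
      rwa [mul_one_div_cancel hδ.ne'] at this
    have h2 : χ x = 1 := by simp [χ, min_eq_left h1]
    simp [g, h2]
  · exact fun x ↦ ⟨χ x, ⟨hχ0 x, hχ1 x⟩, rfl⟩

/-- A map which is constant far away can be given a bump of steepness `ω` there. -/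
theorem exists_add_bump [Nontrivial E] (hconc : ConcaveOn ℝ (Ici 0) ω)
    (hmono : MonotoneOn ω (Ici 0)) (h0 : ω 0 = 0) {s : ℝ} (hs : 0 < s) (hωs : 0 < ω s)
    {g : E → E} (hg : ∀ x y, ‖g x - g y‖ ≤ ω ‖x - y‖) {p q : E} {T R' : ℝ} (hT : 0 < T)
    (hR' : 0 ≤ R') (hgp : ∀ x, R' ≤ ‖x‖ → g x = p) (hpq : ‖q - p‖ ≤ ω s)
    (hp : ∀ y, ‖p - g y‖ ≤ ω (T + ‖y‖)) (hq : ∀ y, ‖q - g y‖ ≤ ω (T + ‖y‖)) :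
    ∃ h : E → E, (∀ x y, ‖h x - h y‖ ≤ ω ‖x - y‖) ∧ (∀ x, ‖x‖ ≤ R' → h x = g x) ∧
      ∃ x y, ‖x - y‖ ≤ s ∧ ‖h x - h y‖ = ‖q - p‖ := by
  obtain ⟨z, hz⟩ := exists_norm_eq E (c := 2 * R' + T + s) (by positivity)
  obtain ⟨w, hw⟩ := exists_norm_eq E (c := s) hs.le
  let v : E → ℝ := fun x ↦ max 0 (ω s - ω ‖x - z‖) / ω s
  have hv0 : ∀ x, 0 ≤ v x := fun x ↦ div_nonneg (le_max_left _ _) hωs.le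
  have hv1 : ∀ x, v x ≤ 1 := fun x ↦ by
    refine (div_le_one hωs).2 (max_le hωs.le ?_)
    have := hmono (mem_Ici.2 le_rfl) (norm_nonneg (x - z)) (norm_nonneg (x - z))
    linarith
  have hvs : ∀ x, s ≤ ‖x - z‖ → v x = 0 := fun x hx ↦ by
    have := hmono hs.le (norm_nonneg (x - z)) hx
    simp only [v]
    rw [max_eq_left (by linarith), zero_div]
  have hvlip : ∀ x y, |v x - v y| * ω s ≤ ω ‖x - y‖ := fun x y ↦ by
    have h1 : |‖x - z‖ - ‖y - z‖| ≤ ‖x - y‖ := by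
      simpa using abs_norm_sub_norm_le (x - z) (y - z)
    have := abs_max_sub_max_le hconc hmono h0 (ω s) (norm_nonneg (x - z)) (norm_nonneg (y - z)) h1
    simp only [v]
    rwa [← sub_div, abs_div, abs_of_pos hωs, div_mul_cancel₀ _ hωs.ne']
  have hvfar : ∀ x, ‖x‖ ≤ R' → v x = 0 := fun x hx ↦ hvs x (by
    have := norm_sub_norm_le z x
    rw [norm_sub_rev] at this
    linarith)
  let h : E → E := fun x ↦ g x + v x • (q - p)
  have hclose : ∀ x, ‖x‖ ≤ R' → h x = g x := fun x hx ↦ by simp [h, hvfar x hx]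
  have hmixed : ∀ x y, R' ≤ ‖x‖ → ‖y‖ ≤ R' → ‖h x - h y‖ ≤ ω ‖x - y‖ := by
    intro x y hx hy
    rw [hclose y hy]
    rcases le_total s ‖x - z‖ with hxz | hxz
    · simpa [h, hvs x hxz] using hg x y
    · have hsplit : h x - g y = (1 - v x) • (p - g y) + v x • (q - g y) := by
        simp only [h, hgp x hx]; module
      have hdist : T + ‖y‖ ≤ ‖x - y‖ := by
        have h1 := norm_sub_norm_le z (z - x)
        have h2 := norm_sub_norm_le x y
        rw [sub_sub_cancel, norm_sub_rev z x] at h1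
        linarith
      refine le_trans ?_ (hmono (by positivity : (0 : ℝ) ≤ T + ‖y‖) (norm_nonneg _) hdist)
      rw [hsplit]
      refine (norm_add_le _ _).trans ?_
      rw [norm_smul, norm_smul, Real.norm_of_nonneg (hv0 x),
        Real.norm_of_nonneg (sub_nonneg.2 (hv1 x))]
      nlinarith [mul_le_mul_of_nonneg_left (hp y) (sub_nonneg.2 (hv1 x)),
        mul_le_mul_of_nonneg_left (hq y) (hv0 x)]
  refine ⟨h, fun x y ↦ ?_, hclose, z, z + w, by simp [hw], ?_⟩
  · rcases le_total R' ‖x‖ with hx | hx <;> rcases le_total R' ‖y‖ with hy | hy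
    · have : h x - h y = (v x - v y) • (q - p) := by
        simp only [h, hgp x hx, hgp y hy]; module
      rw [this, norm_smul, Real.norm_eq_abs]
      exact (mul_le_mul_of_nonneg_left hpq (abs_nonneg _)).trans (hvlip x y)
    · exact hmixed x y hx hy
    · rw [norm_sub_rev, norm_sub_rev x]
      exact hmixed y x hy hx
    · rw [hclose x hx, hclose y hy]
      exact hg x y
  · have hz' : R' ≤ ‖z‖ := by linarith
    have hzw : R' ≤ ‖z + w‖ := by
      have := norm_sub_norm_le z (-w)
      rw [sub_neg_eq_add, norm_neg] at this
      linarith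
    have h1 : v z = 1 := by simp [v, h0, hωs.le, hωs.ne']
    have h2 : v (z + w) = 0 := hvs _ (by simp [hw])
    simp [h, hgp z hz', hgp _ hzw, h1, h2]

/-- The values of a map with slack can be extended by two points at distance almost `ω s`. -/
theorem exists_far_apart_values [Nontrivial E]
    (hnonneg : ∀ s, 0 ≤ s → 0 ≤ ω s) (hmono : MonotoneOn ω (Ici 0)) (h0 : ω 0 = 0)
    {s : ℝ} (hs : 0 < s) (hωs : 0 < ω s) {f : E → E} {δ : ℝ} (hδ : 0 < δ) (hδ1 : δ < 1)
    (hf : ∀ x y, ‖f x - f y‖ ≤ (1 - δ) * ω ‖x - y‖) :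
    ∃ (p q : E) (T : ℝ), 0 < T ∧ (1 - 2 * δ) * ω s < ‖q - p‖ ∧
      (∀ y, ‖p - f y‖ ≤ ω (T + ‖y‖)) ∧ ∀ y, ‖q - f y‖ ≤ ω (T + ‖y‖) := by
  have hf0 : ∀ y, ‖f 0 - f y‖ ≤ (1 - δ) * ω ‖y‖ := fun y ↦ by simpa using hf 0 y
  by_cases hbdd : BddAbove (ω '' Ici 0)
  · set M := sSup (ω '' Ici 0) with hM
    have hle : ∀ t, 0 ≤ t → ω t ≤ M := fun t ht ↦ le_csSup hbdd ⟨t, ht, rfl⟩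
    have hMpos : 0 < M := hωs.trans_le (hle s hs.le)
    have hM0 : 0 ≤ (1 - δ) * M := mul_nonneg (sub_nonneg.2 hδ1.le) hMpos.le
    obtain ⟨_, ⟨T, hT, rfl⟩, hωT⟩ := exists_lt_of_lt_csSup (s := ω '' Ici 0)
      (b := (1 - δ) * M) ⟨ω 0, 0, mem_Ici.2 le_rfl, rfl⟩ (by rw [← hM]; nlinarith)
    have hT' : 0 < T := (mem_Ici.1 hT).lt_of_ne (by rintro rfl; linarith)
    have hfM : ∀ x y, ‖f x - f y‖ ≤ (1 - δ) * M := fun x y ↦ (hf x y).trans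
      (mul_le_mul_of_nonneg_left (hle _ (norm_nonneg _)) (sub_nonneg.2 hδ1.le))
    have hup : ∀ y : E, (1 - δ) * M ≤ ω (T + ‖y‖) := fun y ↦ hωT.le.trans
      (hmono hT (by positivity : (0 : ℝ) ≤ T + ‖y‖) (by linarith [norm_nonneg y]))
    obtain ⟨e, he⟩ := exists_norm_eq E (c := 1) zero_le_one
    let S : Set ℝ := {t | ∀ y, ‖f 0 + t • e - f y‖ ≤ (1 - δ) * M}
    have hSclosed : IsClosed S := by
      simp only [S, ofPred_forall]
      exact isClosed_iInter fun y ↦ isClosed_le (by fun_prop) continuous_const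
    have hS0 : (0 : ℝ) ∈ S := fun y ↦ by simpa using hfM 0 y
    have hSbdd : BddAbove S := ⟨(1 - δ) * M, fun t ht ↦ by
      have := ht 0
      rw [add_sub_cancel_left, norm_smul, he, mul_one] at this
      exact (le_abs_self t).trans this⟩
    have htS : sSup S ∈ S := hSclosed.csSup_mem ⟨0, hS0⟩ hSbdd
    have hnot : sSup S + δ * M ∉ S := fun h ↦ by
      have := le_csSup hSbdd h
      nlinarith [mul_pos hδ hMpos]
    obtain ⟨y, hy⟩ : ∃ y, (1 - δ) * M < ‖f 0 + (sSup S + δ * M) • e - f y‖ := by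
      simpa [S] using hnot
    refine ⟨f 0 + sSup S • e, f y, T, hT', ?_, fun x ↦ (htS x).trans (hup x),
      fun x ↦ (hfM y x).trans (hup x)⟩
    have h1 : ‖f 0 + (sSup S + δ * M) • e - f y‖ ≤ ‖f y - (f 0 + sSup S • e)‖ + δ * M := by
      have : f 0 + (sSup S + δ * M) • e - f y =
          (f 0 + sSup S • e - f y) + (δ * M) • e := by module
      rw [this, norm_sub_rev (f y)]
      refine (norm_add_le _ _).trans_eq ?_
      rw [norm_smul (δ * M), he, mul_one, Real.norm_of_nonneg (mul_pos hδ hMpos).le]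
    have h2 := (norm_nonneg (f y - (f 0 + sSup S • e)))
    have h3 : (1 - 2 * δ) * M < ‖f y - (f 0 + sSup S • e)‖ := by linarith
    have h4 := hle s hs.le
    rcases le_or_gt (2 * δ) 1 with h | h <;> nlinarith
  · obtain ⟨T, hT, hωT⟩ : ∃ T, 0 ≤ T ∧ ω s / δ < ω T := by
      rw [not_bddAbove_iff] at hbdd
      obtain ⟨_, ⟨T, hT, rfl⟩, h⟩ := hbdd (ω s / δ)
      exact ⟨T, hT, h⟩
    have hωT0 : 0 < ω T := (by positivity : 0 < ω s / δ).trans hωT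
    have hT' : 0 < T := hT.lt_of_ne (by rintro rfl; linarith)
    rw [div_lt_iff₀ hδ] at hωT
    obtain ⟨e, he⟩ := exists_norm_eq E (c := ω s) hωs.le
    have h1 : ∀ y : E, ω T ≤ ω (T + ‖y‖) := fun y ↦
      hmono hT (by positivity : (0 : ℝ) ≤ T + ‖y‖) (by linarith [norm_nonneg y])
    have h2 : ∀ y : E, ω ‖y‖ ≤ ω (T + ‖y‖) := fun y ↦
      hmono (norm_nonneg y) (by positivity : (0 : ℝ) ≤ T + ‖y‖) (by linarith)
    refine ⟨f 0, f 0 + e, T, hT', ?_, fun y ↦ ?_, fun y ↦ ?_⟩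
    · rw [add_sub_cancel_left, he]
      nlinarith
    · nlinarith [hf0 y, h2 y, hnonneg _ (norm_nonneg y)]
    · have h3 : ‖f 0 + e - f y‖ ≤ ‖f 0 - f y‖ + ω s := by
        rw [add_sub_right_comm, ← he]
        exact norm_add_le _ _
      nlinarith [hf0 y, mul_le_mul_of_nonneg_left (h1 y) hδ.le,
        mul_le_mul_of_nonneg_left (h2 y) (sub_nonneg.2 hδ1.le)]

/-- A map with slack agrees on any ball with a map whose oscillation at scale `s` is almost
`ω s`. -/
theorem exists_eqOn_ball_of_slack [Nontrivial E] (hconc : ConcaveOn ℝ (Ici 0) ω)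
    (hnonneg : ∀ s, 0 ≤ s → 0 ≤ ω s) (hmono : MonotoneOn ω (Ici 0)) (h0 : ω 0 = 0)
    {s : ℝ} (hs : 0 < s) (hωs : 0 < ω s) {f : E → E} {δ : ℝ} (hδ : 0 < δ) (hδ1 : δ < 1)
    (hf : ∀ x y, ‖f x - f y‖ ≤ (1 - δ) * ω ‖x - y‖) {R : ℝ} (hR : 0 ≤ R) :
    ∃ h : E → E, (∀ x y, ‖h x - h y‖ ≤ ω ‖x - y‖) ∧ (∀ x, ‖x‖ ≤ R → h x = f x) ∧
      ∃ x y, ‖x - y‖ ≤ s ∧ (1 - 2 * δ) * ω s < ‖h x - h y‖ := by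
  obtain ⟨p, q₀, T, hT, hsT, hpq₀, hp, hq₀⟩ : ∃ (p q : E) (T : ℝ), 0 < T ∧ s ≤ T ∧
      (1 - 2 * δ) * ω s < ‖q - p‖ ∧ (∀ y, ‖p - f y‖ ≤ ω (T + ‖y‖)) ∧
      ∀ y, ‖q - f y‖ ≤ ω (T + ‖y‖) := by
    obtain ⟨p, q, T, hT, hpq, hp, hq⟩ :=
      exists_far_apart_values hnonneg hmono h0 hs hωs hδ hδ1 hf
    have hle : ∀ y : E, ω (T + ‖y‖) ≤ ω (T + s + ‖y‖) := fun y ↦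
      hmono (by positivity : (0 : ℝ) ≤ T + ‖y‖) (by positivity : (0 : ℝ) ≤ T + s + ‖y‖)
        (by linarith)
    exact ⟨p, q, T + s, by positivity, by linarith, hpq, fun y ↦ (hp y).trans (hle y),
      fun y ↦ (hq y).trans (hle y)⟩
  obtain ⟨q, hpq, hpq', hq⟩ : ∃ q, (1 - 2 * δ) * ω s < ‖q - p‖ ∧ ‖q - p‖ ≤ ω s ∧
      ∀ y, ‖q - f y‖ ≤ ω (T + ‖y‖) := by
    rcases le_total ‖q₀ - p‖ (ω s) with h | h
    · exact ⟨q₀, hpq₀, h, hq₀⟩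
    · have hpos : 0 < ‖q₀ - p‖ := hωs.trans_le h
      have hc0 : 0 ≤ ω s / ‖q₀ - p‖ := by positivity
      have hc1 : ω s / ‖q₀ - p‖ ≤ 1 := (div_le_one hpos).2 h
      have hnorm : ‖p + (ω s / ‖q₀ - p‖) • (q₀ - p) - p‖ = ω s := by
        rw [add_sub_cancel_left, norm_smul, Real.norm_of_nonneg hc0, div_mul_cancel₀ _ hpos.ne']
      refine ⟨p + (ω s / ‖q₀ - p‖) • (q₀ - p), ?_, hnorm.le, fun y ↦ ?_⟩
      · rw [hnorm]
        nlinarith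
      · have hmem := (convex_closedBall (f y) (ω (T + ‖y‖))).add_smul_sub_mem
          (mem_closedBall_iff_norm.2 (hp y)) (mem_closedBall_iff_norm.2 (hq₀ y)) ⟨hc0, hc1⟩
        exact mem_closedBall_iff_norm.1 hmem
  obtain ⟨g, R', hRR', hg, hgf, hgp, hcomb⟩ :=
    exists_eq_const_far hconc hnonneg hmono h0 hδ hδ1 hf hT hp hR
  have hcomb' : ∀ (r : E), (∀ y, ‖r - f y‖ ≤ ω (T + ‖y‖)) → (∀ y : E, ‖r - p‖ ≤ ω (T + ‖y‖)) →
      ∀ y, ‖r - g y‖ ≤ ω (T + ‖y‖) := by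
    intro r hr hrp y
    obtain ⟨c, ⟨hc0, hc1⟩, hc⟩ := hcomb y
    have hmem := convex_closedBall r (ω (T + ‖y‖)) (mem_closedBall_iff_norm'.2 (hr y))
      (mem_closedBall_iff_norm'.2 (hrp y)) (sub_nonneg.2 hc1) hc0 (by ring)
    rw [← hc] at hmem
    exact mem_closedBall_iff_norm'.1 hmem
  have hpos : ∀ y : E, 0 ≤ T + ‖y‖ := fun y ↦ by positivity
  obtain ⟨h, hh, hhg, x, y, hxy, heq⟩ := exists_add_bump hconc hmono h0 hs hωs hg hT
    (hR.trans hRR') hgp hpq' (hcomb' p hp fun y ↦ by simpa using hnonneg _ (hpos y))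
    (hcomb' q hq fun y ↦ hpq'.trans (hmono hs.le (hpos y) (by linarith [norm_nonneg y])))
  exact ⟨h, hh, fun x hx ↦ (hhg x (hx.trans hRR')).trans (hgf x hx), x, y, hxy, heq ▸ hpq⟩

end Construction
/-- The sets `N(s,μ)` from the proof of the main theorem (normed-space instance): for
every `s > 0` and `μ ∈ (0,1)`, the set of `f ∈ 𝒞_ω(E)` with `ω_f(s) ≤ (1-μ) ω(s)` is
nowhere dense in the topology of uniform convergence on bounded sets (realised via
`UniformOnFun` with the family of bounded sets). -/
theorem stmt_1 {E : Type*} [NormedAddCommGroup E] [NormedSpace ℝ E]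
    [CompleteSpace E] [Nontrivial E]
    (ω : ℝ → ℝ) (hnonneg : ∀ s, 0 ≤ s → 0 ≤ ω s)
    (hconc : ConcaveOn ℝ (Ici 0) ω) (hmono : MonotoneOn ω (Ici 0))
    (h0 : ω 0 = 0) (hne : ∃ s, 0 < s ∧ ω s ≠ 0)
    (s : ℝ) (hs : 0 < s) (μ : ℝ) (hμ : μ ∈ Ioo (0 : ℝ) 1) :
    IsNowhereDense {f : {g : UniformOnFun E E {t : Set E | IsBounded t} //
        ∀ x y : E, ‖UniformOnFun.toFun _ g x - UniformOnFun.toFun _ g y‖ ≤ ω ‖x - y‖} |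
      ∀ x y : E, ‖x - y‖ ≤ s →
        ‖UniformOnFun.toFun _ f.1 x - UniformOnFun.toFun _ f.1 y‖ ≤ (1 - μ) * ω s} := by
  have hωs := hconc.map_pos_of_map_zero hmono hnonneg h0 hne hs
  have hclosed : IsClosed {f : {g : UniformOnFun E E {t : Set E | IsBounded t} //
        ∀ x y : E, ‖UniformOnFun.toFun _ g x - UniformOnFun.toFun _ g y‖ ≤ ω ‖x - y‖} |
      ∀ x y : E, ‖x - y‖ ≤ s →
        ‖UniformOnFun.toFun _ f.1 x - UniformOnFun.toFun _ f.1 y‖ ≤ (1 - μ) * ω s} := by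
    have heval : ∀ x : E, Continuous
        fun g : UniformOnFun E E {t : Set E | IsBounded t} ↦ UniformOnFun.toFun _ g x :=
      fun x ↦ (UniformOnFun.uniformContinuous_eval_of_mem E _ (mem_singleton x)
        (isBounded_singleton : IsBounded {x})).continuous
    simp only [ofPred_forall]
    exact isClosed_iInter fun x ↦ isClosed_iInter fun y ↦ isClosed_iInter fun _ ↦
      isClosed_le (((heval x).comp continuous_subtype_val).sub
        ((heval y).comp continuous_subtype_val)).norm continuous_const
  rw [hclosed.isNowhereDense_iff, eq_empty_iff_forall_notMem]
  intro f hf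
  obtain ⟨F, hF⟩ := f
  let δ : ℕ → ℝ := fun n ↦ μ / 2 / (n + 1)
  have hδ : ∀ n, 0 < δ n := fun n ↦ div_pos (half_pos hμ.1) n.cast_add_one_pos
  have hδμ : ∀ n, δ n ≤ μ / 2 := fun n ↦
    div_le_self (half_pos hμ.1).le (by linarith [n.cast_nonneg (α := ℝ)])
  have hδlim : Filter.Tendsto δ Filter.atTop (nhds 0) :=
    tendsto_const_div_atTop_nhds_zero_nat (μ / 2) |>.comp (Filter.tendsto_add_atTop_nat 1)
      |>.congr fun n ↦ by simp [δ]
  have hex : ∀ n : ℕ, ∃ h : E → E, (∀ x y, ‖h x - h y‖ ≤ ω ‖x - y‖) ∧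
      (∀ x, ‖x‖ ≤ n → h x = (1 - δ n) • UniformOnFun.toFun _ F x) ∧
      ∃ x y, ‖x - y‖ ≤ s ∧ (1 - 2 * δ n) * ω s < ‖h x - h y‖ := by
    intro n
    have hδ1 : δ n < 1 := by linarith [hδμ n, hμ.2, hμ.1]
    refine exists_eqOn_ball_of_slack hconc hnonneg hmono h0 hs hωs (hδ n) hδ1
      (fun x y ↦ ?_) n.cast_nonneg
    rw [← smul_sub, norm_smul, Real.norm_of_nonneg (sub_nonneg.2 hδ1.le)]
    exact mul_le_mul_of_nonneg_left (hF x y) (sub_nonneg.2 hδ1.le)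
  choose h hh hhF hosc using hex
  have hlim : Filter.Tendsto (fun n ↦ (⟨UniformOnFun.ofFun _ (h n), hh n⟩ :
      {g : UniformOnFun E E {t : Set E | IsBounded t} //
        ∀ x y : E, ‖UniformOnFun.toFun _ g x - UniformOnFun.toFun _ g y‖ ≤ ω ‖x - y‖}))
      Filter.atTop (nhds ⟨F, hF⟩) := by
    rw [tendsto_subtype_rng, UniformOnFun.tendsto_iff_tendstoUniformlyOn]
    intro t ht
    obtain ⟨C, hC⟩ := ht.exists_norm_le
    rw [Metric.tendstoUniformlyOn_iff]
    intro ε hε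
    have hsmall : ∀ᶠ n in Filter.atTop, δ n * (‖UniformOnFun.toFun _ F 0‖ + ω |C|) < ε :=
      ((hδlim.mul_const _).congr fun _ ↦ rfl).eventually_lt_const (by simpa using hε)
    filter_upwards [hsmall, Filter.eventually_ge_atTop ⌈C⌉₊] with n hn hnC x hx
    have hxC := hC x hx
    have hval : h n x = (1 - δ n) • UniformOnFun.toFun _ F x :=
      hhF n x (hxC.trans ((Nat.le_ceil C).trans (by exact_mod_cast hnC)))
    have hdiff : UniformOnFun.toFun _ F x - h n x = δ n • UniformOnFun.toFun _ F x := by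
      rw [hval]; module
    have hnorm : ‖UniformOnFun.toFun _ F x‖ ≤ ‖UniformOnFun.toFun _ F 0‖ + ω |C| := by
      have h1 := norm_le_norm_add_norm_sub' (UniformOnFun.toFun _ F x) (UniformOnFun.toFun _ F 0)
      have h2 := hF x 0
      rw [sub_zero] at h2
      linarith [hmono (norm_nonneg x) (abs_nonneg C) (hxC.trans (le_abs_self C))]
    change dist (UniformOnFun.toFun _ F x) (h n x) < ε
    rw [dist_eq_norm, hdiff, norm_smul, Real.norm_of_nonneg (hδ n).le]
    exact (mul_le_mul_of_nonneg_left hnorm (hδ n).le).trans_lt hn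
  obtain ⟨n, hn⟩ := (hlim.eventually (mem_interior_iff_mem_nhds.1 hf)).exists
  obtain ⟨x, y, hxy, hlt⟩ := hosc n
  have hle : ‖h n x - h n y‖ ≤ (1 - μ) * ω s := hn x y hxy
  nlinarith [mul_le_mul_of_nonneg_right (hδμ n) hωs.le]
end

section
/- Let E be a nontrivial real Banach space and let ω : [0,∞) → [0,∞) be continuous, subadditive, nondecreasing, not identically zero, with ω(0) = 0. Let 𝒞ᵇ_ω(E) be the set of maps f : E → E with ‖f(x) − f(y)‖ ≤ ω(‖x − y‖) for all x, y and with bounded range, equipped with the supremum metric d∞(f,g) = sup_{x ∈ E} ‖f(x) − g(x)‖. Then there is a countable family of subsets P_k ⊆ 𝒞ᵇ_ω(E), each of which is lower porous with respect to d∞, such that every f ∈ 𝒞ᵇ_ω(E) for which ω_f(s) = ω(s) at some point s > 0 belongs to ⋃_k P_k; consequently, outside the σ-lower porous set ⋃_k P_k, every f satisfies ω_f(s) < ω(s) for every s > 0. -/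
open Set

/-- The space `𝒞ᵇ_ω(E)` of `ω`-uniformly continuous self-maps of `E` with bounded range. -/
def CbOmega {E : Type*} [NormedAddCommGroup E] (ω : ℝ → ℝ) : Set (E → E) :=
  {f : E → E | (∀ x y : E, ‖f x - f y‖ ≤ ω ‖x - y‖) ∧
    ∃ B : ℝ, ∀ x y : E, ‖f x - f y‖ ≤ B}

/-- The supremum distance `d∞` on `𝒞ᵇ_ω(E)`. -/
noncomputable def dInf {E : Type*} [NormedAddCommGroup E] (f g : E → E) : ℝ :=
  sSup (Set.range fun x : E => ‖f x - g x‖)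

/-- The modulus of continuity `ω_f(s) = sup {‖f x - f y‖ : ‖x - y‖ ≤ s}`. -/
noncomputable def modCont {E : Type*} [NormedAddCommGroup E] (f : E → E) (s : ℝ) : ℝ :=
  sSup {d : ℝ | ∃ x y : E, ‖x - y‖ ≤ s ∧ d = ‖f x - f y‖}

section

variable {E : Type*} [NormedAddCommGroup E] {ω : ℝ → ℝ} {f g : E → E}

/-- Maps in `𝒞ᵇ_ω(E)` are uniformly bounded in norm. -/
lemma CbOmega.exists_norm_le (hf : f ∈ CbOmega ω) : ∃ M : ℝ, 0 ≤ M ∧ ∀ x, ‖f x‖ ≤ M := by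
  obtain ⟨-, B, hB⟩ := hf
  have hM : ∀ x, ‖f x‖ ≤ ‖f 0‖ + B := fun x => by
    have h1 := norm_le_norm_add_norm_sub (f 0) (f x)
    have h2 := hB 0 x
    linarith
  exact ⟨‖f 0‖ + B, (norm_nonneg _).trans (hM 0), hM⟩

lemma CbOmega.norm_sub_le_dInf (hf : f ∈ CbOmega ω) (hg : g ∈ CbOmega ω) (x : E) :
    ‖f x - g x‖ ≤ dInf f g := by
  obtain ⟨M, -, hM⟩ := exists_norm_le hf
  obtain ⟨N, -, hN⟩ := exists_norm_le hg
  refine le_csSup ⟨M + N, ?_⟩ ⟨x, rfl⟩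
  rintro _ ⟨y, rfl⟩
  exact (norm_sub_le _ _).trans (add_le_add (hM y) (hN y))

lemma dInf_le {r : ℝ} (h : ∀ x, ‖f x - g x‖ ≤ r) : dInf f g ≤ r :=
  csSup_le (range_nonempty _) (by rintro _ ⟨x, rfl⟩; exact h x)

lemma modCont_le {s r : ℝ} (hs : 0 ≤ s) (h : ∀ x y : E, ‖x - y‖ ≤ s → ‖f x - f y‖ ≤ r) :
    modCont f s ≤ r := by
  refine csSup_le ⟨_, 0, 0, by simpa using hs, rfl⟩ ?_
  rintro _ ⟨x, y, hxy, rfl⟩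
  exact h x y hxy

lemma CbOmega.modCont_le (hmono : MonotoneOn ω (Ici 0)) (hf : f ∈ CbOmega ω) {s : ℝ}
    (hs : 0 ≤ s) : modCont f s ≤ ω s :=
  _root_.modCont_le hs fun x y hxy => (hf.1 x y).trans (hmono (norm_nonneg _) hs hxy)

/-- Shrinking a map in `𝒞ᵇ_ω(E)` by a factor `c ∈ [0, 1]` stays in `𝒞ᵇ_ω(E)`. -/
lemma CbOmega.smul_mem [NormedSpace ℝ E] (hf : f ∈ CbOmega ω) {c : ℝ} (hc : 0 ≤ c)
    (hc1 : c ≤ 1) : (fun x => c • f x) ∈ CbOmega ω := by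
  have key : ∀ x y, ‖c • f x - c • f y‖ ≤ ‖f x - f y‖ := fun x y => by
    rw [← smul_sub, norm_smul, Real.norm_of_nonneg hc]
    exact mul_le_of_le_one_left (norm_nonneg _) hc1
  obtain ⟨hω, B, hB⟩ := hf
  exact ⟨fun x y => (key x y).trans (hω x y), B, fun x y => (key x y).trans (hB x y)⟩

end

/-- A nonnegative, nondecreasing, subadditive function on `[0, ∞)` that is not identically zero
is positive on `(0, ∞)`. -/
lemma pos_of_subadditive_of_monotoneOn {ω : ℝ → ℝ} (hnonneg : ∀ s, 0 ≤ s → 0 ≤ ω s)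
    (hsub : ∀ a b : ℝ, 0 ≤ a → 0 ≤ b → ω (a + b) ≤ ω a + ω b)
    (hmono : MonotoneOn ω (Ici 0)) (h0 : ω 0 = 0) (hne : ∃ s, 0 < s ∧ ω s ≠ 0)
    {t : ℝ} (ht : 0 < t) : 0 < ω t := by
  obtain ⟨s, hs, hωs⟩ := hne
  refine (hnonneg t ht.le).lt_of_ne' fun hωt => hωs ?_
  have hmul : ∀ n : ℕ, ω (n * t) ≤ 0 := by
    intro n
    induction n with
    | zero => simp [h0]
    | succ n ih =>
      have h := hsub (n * t) t (by positivity) ht.le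
      rw [Nat.cast_succ, add_one_mul]
      linarith
  obtain ⟨n, hn⟩ := Archimedean.arch s ht
  rw [nsmul_eq_mul] at hn
  exact le_antisymm ((hmono hs.le (hs.le.trans hn) hn).trans (hmul n)) (hnonneg s hs.le)

/-- For `t > 0`, the set of maps whose modulus of continuity touches `ω` at some scale `s ≥ t`
is lower porous. -/
lemma lowerPorous_modCont_eq {E : Type*} [NormedAddCommGroup E] [NormedSpace ℝ E] {ω : ℝ → ℝ}
    (hmono : MonotoneOn ω (Ici 0)) {t : ℝ} (ht : 0 < t) (hωt : 0 < ω t)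
    {f : E → E} (hf : f ∈ CbOmega ω) :
    ∃ ε₀ > (0 : ℝ), ∃ α > (0 : ℝ), ∀ ε : ℝ, 0 < ε → ε ≤ ε₀ → ∃ g ∈ CbOmega ω,
      ∀ h ∈ CbOmega ω, dInf g h < α * ε →
        dInf f h < ε ∧ h ∉ {f : E → E | f ∈ CbOmega ω ∧ ∃ s, t ≤ s ∧ modCont f s = ω s} := by
  obtain ⟨M, hM0, hM⟩ := CbOmega.exists_norm_le hf
  have hM1 : 0 < M + 1 := by linarith
  refine ⟨1, one_pos, min (1 / 2) (ω t / (8 * (M + 1))), by positivity, fun ε hε hε1 => ?_⟩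
  set l : ℝ := ε / (2 * (M + 1)) with hl
  have hlpos : 0 < l := by positivity
  have hlM : l * (M + 1) = ε / 2 := by rw [hl]; field_simp
  have hl1 : l ≤ 1 := by nlinarith
  have hg : (fun x => (1 - l) • f x) ∈ CbOmega ω :=
    CbOmega.smul_mem hf (sub_nonneg.2 hl1) (by linarith)
  refine ⟨_, hg, fun h hh hgh => ?_⟩
  set d := dInf (fun x => (1 - l) • f x) h
  have hd : ∀ x, ‖(1 - l) • f x - h x‖ ≤ d := CbOmega.norm_sub_le_dInf hg hh
  have hd_half : d < ε / 2 := by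
    have := mul_le_mul_of_nonneg_right (min_le_left (1 / 2) (ω t / (8 * (M + 1)))) hε.le
    linarith
  have hd_small : d < l * ω t / 4 := by
    have h1 := mul_le_mul_of_nonneg_right (min_le_right (1 / 2) (ω t / (8 * (M + 1)))) hε.le
    have h2 : ω t / (8 * (M + 1)) * ε = l * ω t / 4 := by rw [hl]; field_simp; norm_num
    linarith
  refine ⟨?_, ?_⟩
  · refine (dInf_le (r := l * M + d) fun x => ?_).trans_lt (by nlinarith)
    have hx : f x - h x = l • f x + ((1 - l) • f x - h x) := by module
    rw [hx]
    refine (norm_add_le _ _).trans (add_le_add ?_ (hd x))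
    rw [norm_smul, Real.norm_of_nonneg hlpos.le]
    exact mul_le_mul_of_nonneg_left (hM x) hlpos.le
  · rintro ⟨-, s, hts, hs⟩
    have hs0 : 0 ≤ s := ht.le.trans hts
    have hωs : ω t ≤ ω s := hmono ht.le hs0 hts
    have hle : modCont h s ≤ (1 - l) * ω s + 2 * d := by
      refine modCont_le hs0 fun x y hxy => ?_
      have hxy' : h x - h y = (1 - l) • (f x - f y) + ((1 - l) • f y - h y)
          - ((1 - l) • f x - h x) := by module
      have h1 : ‖(1 - l) • (f x - f y)‖ ≤ (1 - l) * ω s := by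
        rw [norm_smul, Real.norm_of_nonneg (sub_nonneg.2 hl1)]
        exact mul_le_mul_of_nonneg_left
          ((hf.1 x y).trans (hmono (norm_nonneg _) hs0 hxy)) (sub_nonneg.2 hl1)
      rw [hxy']
      have h2 := norm_sub_le ((1 - l) • (f x - f y) + ((1 - l) • f y - h y))
        ((1 - l) • f x - h x)
      have h3 := norm_add_le ((1 - l) • (f x - f y)) ((1 - l) • f y - h y)
      linarith [hd x, hd y]
    have h4 := mul_le_mul_of_nonneg_left hωs hlpos.le
    have h5 := mul_pos hlpos hωt
    linarith

/-- Theorem `theo:uniftop` (normed-space instance): there is a countable family of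
subsets of `𝒞ᵇ_ω(E)`, each lower porous for the supremum metric `d∞`, covering all maps
whose modulus of continuity touches `ω` at some positive scale; outside this σ-lower
porous set, `ω_f(s) < ω(s)` for every `s > 0`. -/
theorem stmt_3 {E : Type*} [NormedAddCommGroup E] [NormedSpace ℝ E]
    [CompleteSpace E] [Nontrivial E]
    (ω : ℝ → ℝ) (hnonneg : ∀ s, 0 ≤ s → 0 ≤ ω s)
    (hcont : ContinuousOn ω (Ici 0))
    (hsub : ∀ a b : ℝ, 0 ≤ a → 0 ≤ b → ω (a + b) ≤ ω a + ω b)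
    (hmono : MonotoneOn ω (Ici 0)) (h0 : ω 0 = 0)
    (hne : ∃ s, 0 < s ∧ ω s ≠ 0) :
    ∃ P : ℕ → Set (E → E),
      (∀ k : ℕ, P k ⊆ CbOmega ω) ∧
      -- each `P k` is lower porous in `(𝒞ᵇ_ω(E), d∞)`
      (∀ k : ℕ, ∀ f ∈ CbOmega ω, ∃ ε₀ > (0 : ℝ), ∃ α > (0 : ℝ),
        ∀ ε : ℝ, 0 < ε → ε ≤ ε₀ → ∃ g ∈ CbOmega ω,
          ∀ h ∈ CbOmega ω, dInf g h < α * ε → dInf f h < ε ∧ h ∉ P k) ∧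
      -- the sets `P k` cover every `f` whose modulus of continuity touches `ω`
      (∀ f ∈ CbOmega ω, (∃ s : ℝ, 0 < s ∧ modCont f s = ω s) → ∃ k : ℕ, f ∈ P k) ∧
      -- consequently, outside `⋃ k, P k` the modulus is strictly below `ω` everywhere
      (∀ f ∈ CbOmega ω, f ∉ (⋃ k : ℕ, P k) → ∀ s : ℝ, 0 < s → modCont f s < ω s) := by
  have hpos : ∀ k : ℕ, (0 : ℝ) < 1 / (k + 1) := fun k => Nat.one_div_pos_of_nat
  have hcover : ∀ f ∈ CbOmega (E := E) ω, (∃ s : ℝ, 0 < s ∧ modCont f s = ω s) →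
      ∃ k : ℕ, f ∈ CbOmega ω ∧ ∃ s, 1 / ((k : ℝ) + 1) ≤ s ∧ modCont f s = ω s := by
    rintro f hf ⟨s, hs, hfs⟩
    obtain ⟨k, hk⟩ := exists_nat_one_div_lt hs
    exact ⟨k, hf, s, hk.le, hfs⟩
  refine ⟨fun k => {f | f ∈ CbOmega ω ∧ ∃ s, 1 / ((k : ℝ) + 1) ≤ s ∧ modCont f s = ω s},
    fun k f hf => hf.1, fun k f hf => lowerPorous_modCont_eq hmono (hpos k)
      (pos_of_subadditive_of_monotoneOn hnonneg hsub hmono h0 hne (hpos k)) hf,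
    hcover, fun f hf hfP s hs => ?_⟩
  exact (CbOmega.modCont_le hmono hf hs.le).lt_of_ne fun hfs =>
    hfP (mem_iUnion.2 (hcover f hf ⟨s, hs, hfs⟩))
end

section
/- Let E be a real normed space, let z₀ ∈ E and let δ, r be real numbers with 0 < δ < r. Then there exists a map Φ : E → E such that: (1) Φ(x) = z₀ for every x with ‖x − z₀‖ ≤ δ; (2) Φ(x) = x for every x with ‖x − z₀‖ ≥ r; (3) Φ is Lipschitz with Lipschitz constant at most r/(r − δ). -/
open Set

/-- A radial map `x ↦ g ‖x‖ • x` is `L`-Lipschitz as soon as `g` is nonnegative, monotone and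
bounded by `L`, and the radial profile `t ↦ g t * t` grows at rate at most `L`. -/
lemma lipschitzWith_radial_smul {E : Type*} [NormedAddCommGroup E] [NormedSpace ℝ E]
    {g : ℝ → ℝ} {L : ℝ} (hg : Monotone g) (hg0 : ∀ t, 0 ≤ g t) (hgL : ∀ t, g t ≤ L)
    (hgrowth : ∀ s t, 0 ≤ s → s ≤ t → g t * t - g s * s ≤ L * (t - s)) :
    LipschitzWith L.toNNReal fun x : E => g ‖x‖ • x := by
  have hL : 0 ≤ L := (hg0 0).trans (hgL 0)
  have key : ∀ x y : E, ‖y‖ ≤ ‖x‖ → ‖g ‖x‖ • x - g ‖y‖ • y‖ ≤ L * ‖x - y‖ := by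
    intro x y hyx
    have hsplit : g ‖x‖ • x - g ‖y‖ • y = g ‖x‖ • (x - y) + (g ‖x‖ - g ‖y‖) • y := by
      module
    have htri : ‖x‖ - ‖y‖ ≤ ‖x - y‖ := norm_sub_norm_le x y
    calc ‖g ‖x‖ • x - g ‖y‖ • y‖
        ≤ ‖g ‖x‖ • (x - y)‖ + ‖(g ‖x‖ - g ‖y‖) • y‖ := hsplit ▸ norm_add_le _ _
      _ = g ‖x‖ * ‖x - y‖ + (g ‖x‖ - g ‖y‖) * ‖y‖ := by
        rw [norm_smul, norm_smul, Real.norm_of_nonneg (hg0 _),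
          Real.norm_of_nonneg (sub_nonneg.2 (hg hyx))]
      _ ≤ L * ‖x - y‖ := by
        nlinarith [hgrowth ‖y‖ ‖x‖ (norm_nonneg y) hyx,
          mul_nonneg (sub_nonneg.2 (hgL ‖x‖)) (sub_nonneg.2 htri)]
  refine LipschitzWith.of_dist_le_mul fun x y => ?_
  rw [Real.coe_toNNReal L hL, dist_eq_norm, dist_eq_norm]
  rcases le_total ‖y‖ ‖x‖ with h | h
  · exact key x y h
  · rw [norm_sub_rev, norm_sub_rev x y]
    exact key y x h

/-- The factor by which the retraction scales a vector of norm `t`: it vanishes for `t ≤ δ`, and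
for `L = r / (r - δ)` it is `1` for `t ≥ r`. -/
noncomputable def collapseFactor (δ L t : ℝ) : ℝ := min 1 (L * (1 - δ / max δ t))

section collapseFactor

variable {δ L : ℝ}

lemma collapseFactor_of_le (hδ : 0 < δ) {t : ℝ} (ht : t ≤ δ) : collapseFactor δ L t = 0 := by
  simp [collapseFactor, max_eq_left ht, hδ.ne']

lemma collapseFactor_of_ge {r t : ℝ} (hδ : 0 < δ) (hδr : δ < r) (ht : r ≤ t) :
    collapseFactor δ (r / (r - δ)) t = 1 := by
  have hrδ : 0 < r - δ := sub_pos.2 hδr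
  have ht0 : 0 < t := by linarith
  rw [collapseFactor, max_eq_right (hδr.le.trans ht), min_eq_left]
  have hrw : r / (r - δ) * (1 - δ / t) = r * (t - δ) / ((r - δ) * t) := by
    field_simp
  rw [hrw, one_le_div (by positivity)]
  nlinarith

lemma collapseFactor_monotone (hδ : 0 < δ) (hL : 0 ≤ L) : Monotone (collapseFactor δ L) := by
  intro s t hst
  have : 0 < max δ s := lt_max_of_lt_left hδ
  unfold collapseFactor
  gcongr

lemma collapseFactor_nonneg (hδ : 0 < δ) (hL : 0 ≤ L) (t : ℝ) : 0 ≤ collapseFactor δ L t := by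
  have : δ / max δ t ≤ 1 := div_le_one_of_le₀ (le_max_left _ _) (hδ.le.trans (le_max_left _ _))
  exact le_min zero_le_one (mul_nonneg hL (sub_nonneg.2 this))

lemma collapseFactor_mul_self (hδ : 0 < δ) {t : ℝ} (ht : 0 ≤ t) :
    collapseFactor δ L t * t = min t (L * (max δ t - δ)) := by
  rcases le_total t δ with h | h
  · simp [collapseFactor_of_le hδ h, max_eq_left h, ht]
  · have ht0 : t ≠ 0 := (hδ.trans_le h).ne'
    rw [collapseFactor, max_eq_right h, min_mul_of_nonneg _ _ ht, one_mul]
    congr 1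
    field_simp

lemma collapseFactor_mul_self_sub_le (hδ : 0 < δ) (hL : 1 ≤ L) {s t : ℝ} (hs : 0 ≤ s)
    (hst : s ≤ t) :
    collapseFactor δ L t * t - collapseFactor δ L s * s ≤ L * (t - s) := by
  rw [collapseFactor_mul_self hδ hs, collapseFactor_mul_self hδ (hs.trans hst)]
  have hmax : max δ t ≤ max δ s + (t - s) :=
    max_le (by linarith [le_max_left δ s]) (by linarith [le_max_right δ s])
  rw [sub_le_iff_le_add', ← min_add_add_right]
  refine min_le_min ?_ ?_ <;> nlinarith

end collapseFactor

/-- Lemma `lemma:michael` (normed-space instance, due to Dymond): given `z₀ ∈ E` and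
`0 < δ < r`, there is a map `Φ : E → E` collapsing the ball `B(z₀, δ)` to `z₀`, equal to
the identity outside `B(z₀, r)`, and Lipschitz with constant at most `r / (r - δ)`. -/
theorem stmt_10 {E : Type*} [NormedAddCommGroup E] [NormedSpace ℝ E]
    (z₀ : E) (δ r : ℝ) (hδ : 0 < δ) (hδr : δ < r) :
    ∃ Φ : E → E,
      (∀ x : E, ‖x - z₀‖ ≤ δ → Φ x = z₀) ∧
      (∀ x : E, r ≤ ‖x - z₀‖ → Φ x = x) ∧
      LipschitzWith (Real.toNNReal (r / (r - δ))) Φ := by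
  have hL : 1 ≤ r / (r - δ) := (one_le_div (sub_pos.2 hδr)).2 (by linarith)
  have hL0 : 0 ≤ r / (r - δ) := zero_le_one.trans hL
  refine ⟨fun x => collapseFactor δ (r / (r - δ)) ‖x - z₀‖ • (x - z₀) + z₀,
    fun x hx => ?_, fun x hx => ?_, ?_⟩
  · simp [collapseFactor_of_le hδ hx]
  · simp [collapseFactor_of_ge hδ hδr hx]
  · have hlip := lipschitzWith_radial_smul (E := E) (collapseFactor_monotone hδ hL0)
      (collapseFactor_nonneg hδ hL0) (fun t => (min_le_left _ _).trans hL)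
      (fun s t => collapseFactor_mul_self_sub_le hδ hL)
    refine LipschitzWith.of_dist_le_mul fun x y => ?_
    simpa using hlip.dist_le_mul (x - z₀) (y - z₀)
end
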